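/- For every integer n ≥ 3 and every k ∈ ℕ there exists a game space (X,d) whose underlying topological space is homeomorphic to the n-sphere 𝕊ⁿ = {x ∈ ℝ^{n+1} : |x| = 1} and whose cop number satisfies c(X) > k. -/

import Mathlib

/-!
Game of Cops and Robber on metric spaces, following Mohar, formalized relative to an
explicit distance function `d : Y → Y → ℝ`.
-/

open Set Filter Topology

/-- The length of (the restriction to `[0,1]` of) a map `p : ℝ → Y` with respect to an
extended-real-valued cost function `c`, defined as the supremum over all finite monotone
partitions of `[0,1]` of the sums of the costs of consecutive points. -/
noncomputable def elen {Y : Type*} (c : Y → Y → ENNReal) (p : ℝ → Y) : ENNReal :=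
  ⨆ q : ℕ × {u : ℕ → ℝ // Monotone u ∧ ∀ i, u i ∈ Set.Icc (0 : ℝ) 1},
    ∑ i ∈ Finset.range q.1, c (p (q.2.1 i)) (p (q.2.1 (i + 1)))

/-- Continuity on `[0,1]` of a map `p : ℝ → Y` with respect to a cost function `c`,
stated in `ε`-`δ` form. -/
def econt {Y : Type*} (c : Y → Y → ENNReal) (p : ℝ → Y) : Prop :=
  ∀ t ∈ Set.Icc (0 : ℝ) 1, ∀ ε : ENNReal, 0 < ε →
    ∃ δ : ℝ, 0 < δ ∧ ∀ t' ∈ Set.Icc (0 : ℝ) 1, |t' - t| < δ → c (p t) (p t') < ε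

/-- `d` is a metric on `Y`. -/
def IsMetricD (Y : Type*) (d : Y → Y → ℝ) : Prop :=
  (∀ x, d x x = 0) ∧ (∀ x y, d x y = 0 → x = y) ∧
    (∀ x y, d x y = d y x) ∧ (∀ x y z, d x z ≤ d x y + d y z)

/-- Compactness of the metric space `(Y,d)`, in its sequential form: every sequence has a
convergent subsequence. -/
def CompactD (Y : Type*) (d : Y → Y → ℝ) : Prop :=
  ∀ u : ℕ → Y, ∃ (x : Y) (φ : ℕ → ℕ), StrictMono φ ∧
    Filter.Tendsto (fun n => d (u (φ n)) x) Filter.atTop (nhds 0)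

/-- `(Y,d)` is a geodesic metric space: any two points `x, y` are joined by a continuous
path `p : [0,1] → Y` whose length equals `d x y`. -/
def IsGeodesicD (Y : Type*) (d : Y → Y → ℝ) : Prop :=
  ∀ x y : Y, ∃ p : ℝ → Y,
    econt (fun a b => ENNReal.ofReal (d a b)) p ∧ p 0 = x ∧ p 1 = y ∧
      elen (fun a b => ENNReal.ofReal (d a b)) p = ENNReal.ofReal (d x y)

/-- A game space is a (nonempty) compact geodesic metric space. -/
def GameSpaceD (Y : Type*) (d : Y → Y → ℝ) : Prop :=
  Nonempty Y ∧ IsMetricD Y d ∧ CompactD Y d ∧ IsGeodesicD Y d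

/-- An agility function: positive, with divergent sum. -/
def IsAgility (τ : ℕ → ℝ) : Prop := (∀ n, 0 < τ n) ∧ ¬ Summable τ

/-- The trajectory of the `k` cops determined by initial positions `c0`, a cop strategy `σ`
(where `σ n` computes the cops' positions at step `n+1` from the robber's positions
`r^0, …, r^(n+1)`), and a robber trajectory `r`. -/
def copTraj {Y : Type*} {k : ℕ} (c0 : Fin k → Y)
    (σ : (n : ℕ) → (Fin (n + 2) → Y) → Fin k → Y) (r : ℕ → Y) : ℕ → Fin k → Y
  | 0 => c0
  | n + 1 => σ n fun i => r i

/-- The trajectory of the robber determined by his initial position `r0`, a robber strategy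
`ρ` (where `ρ n` computes the robber's position at step `n+1` from the cops' positions
`c^0, …, c^n`), and a cop trajectory `c`. -/
def robTraj {Y : Type*} {k : ℕ} (r0 : Y)
    (ρ : (n : ℕ) → (Fin (n + 1) → Fin k → Y) → Y) (c : ℕ → Fin k → Y) : ℕ → Y
  | 0 => r0
  | n + 1 => ρ n fun i => c i

/-- `k` cops have a winning strategy on `(Y,d)`: for every agility function and every initial
position chosen by the robber there is a cop strategy `σ`, assigning legal cop moves to every
history, such that against every legal robber trajectory the cops come arbitrarily close to
the robber. -/
def CopsWinWith (Y : Type*) (d : Y → Y → ℝ) (k : ℕ) : Prop :=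
  ∀ τ : ℕ → ℝ, IsAgility τ → ∀ r0 : Y, ∀ c0 : Fin k → Y,
    ∃ σ : (n : ℕ) → (Fin (n + 2) → Y) → Fin k → Y,
      ∀ r : ℕ → Y, r 0 = r0 → (∀ n, d (r n) (r (n + 1)) ≤ τ (n + 1)) →
        (∀ n i, d (copTraj c0 σ r n i) (copTraj c0 σ r (n + 1) i) ≤ τ (n + 1)) ∧
          (∀ ε : ℝ, 0 < ε → ∃ n i, d (r n) (copTraj c0 σ r n i) < ε)

/-- The cop number of `(Y,d)`, as an extended natural number: the least `k` such that `k`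
cops have a winning strategy (`⊤` if there is no such `k`). -/
noncomputable def copNumber (Y : Type*) (d : Y → Y → ℝ) : ℕ∞ :=
  sInf {m : ℕ∞ | ∃ k : ℕ, m = (k : ℕ∞) ∧ CopsWinWith Y d k}

/-- The robber has a strategy against `k` cops on `(Y,d)` with agility function `τ` which
guarantees that his moves are legal and that every cop always stays at distance `> ε` from
him, against every legal cop play. -/
def RobberWins (Y : Type*) (d : Y → Y → ℝ) (k : ℕ) (τ : ℕ → ℝ) (ε : ℝ) : Prop :=
  ∃ (r0 : Y) (c0 : Fin k → Y) (ρ : (n : ℕ) → (Fin (n + 1) → Fin k → Y) → Y),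
    ∀ c : ℕ → Fin k → Y, c 0 = c0 → (∀ n i, d (c n i) (c (n + 1) i) ≤ τ (n + 1)) →
      (∀ n, d (robTraj r0 ρ c n) (robTraj r0 ρ c (n + 1)) ≤ τ (n + 1)) ∧
        (∀ n i, ε < d (robTraj r0 ρ c n) (c n i))

/-- `D` is a real-valued pseudometric. -/
structure IsPseudo {X : Type*} (D : X → X → ℝ) : Prop where
  self : ∀ x, D x x = 0
  symm : ∀ x y, D x y = D y x
  tri : ∀ x y z, D x z ≤ D x y + D y z

lemma IsPseudo.nonneg {X : Type*} {D : X → X → ℝ} (h : IsPseudo D) (x y : X) : 0 ≤ D x y := by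
  have := h.tri x y x
  rw [h.self, h.symm y x] at this
  linarith

lemma IsPseudo.const_mul {X : Type*} {D : X → X → ℝ} (h : IsPseudo D) {c : ℝ} (hc : 0 ≤ c) :
    IsPseudo fun x y => c * D x y where
  self x := by simp [h.self]
  symm x y := by rw [h.symm]
  tri x y z := by rw [← mul_add]; exact mul_le_mul_of_nonneg_left (h.tri x y z) hc

section Glue

variable {X W : Type*} {D : X → X → ℝ} {f : W → X} {δ : W → W → ℝ}

/-- The largest pseudometric below `D` whose pullback along `f` is below `δ`, when `D` and `δ` are
pseudometrics with `δ ≤ D ∘ f`. -/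
noncomputable def glue (D : X → X → ℝ) (f : W → X) (δ : W → W → ℝ) (x y : X) : ℝ :=
  min (D x y) (⨅ u : W × W, D x (f u.1) + δ u.1 u.2 + D (f u.2) y)

lemma glue_le_base (x y : X) : glue D f δ x y ≤ D x y := min_le_left _ _

lemma glue_le_via (hD : IsPseudo D) (hδ : IsPseudo δ) (x y : X) (u u' : W) :
    glue D f δ x y ≤ D x (f u) + δ u u' + D (f u') y := by
  refine (min_le_right _ _).trans (ciInf_le (f := fun u : W × W => _) ⟨0, ?_⟩ (u, u'))
  rintro _ ⟨v, rfl⟩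
  have := hD.nonneg x (f v.1)
  have := hD.nonneg (f v.2) y
  have := hδ.nonneg v.1 v.2
  simp only
  linarith

lemma glue_lt [Nonempty W] {x y : X} {c : ℝ} (h : glue D f δ x y < c) :
    D x y < c ∨ ∃ u u', D x (f u) + δ u u' + D (f u') y < c := by
  rcases min_lt_iff.1 h with h | h
  · exact .inl h
  · obtain ⟨⟨u, u'⟩, h⟩ := exists_lt_of_ciInf_lt h
    exact .inr ⟨u, u', h⟩

lemma le_glue [Nonempty W] {ρ : X → X → ℝ} (hρ : IsPseudo ρ) (h1 : ∀ x y, ρ x y ≤ D x y)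
    (h2 : ∀ u u', ρ (f u) (f u') ≤ δ u u') (x y : X) : ρ x y ≤ glue D f δ x y := by
  refine le_min (h1 x y) (le_ciInf fun u => ?_)
  have := hρ.tri x (f u.1) y
  have := hρ.tri (f u.1) (f u.2) y
  have := h1 x (f u.1)
  have := h1 (f u.2) y
  have := h2 u.1 u.2
  linarith

lemma glue_image_le (hD : IsPseudo D) (hδ : IsPseudo δ) (u u' : W) :
    glue D f δ (f u) (f u') ≤ δ u u' := by
  have := glue_le_via (f := f) hD hδ (f u) (f u') u u'
  rw [hD.self, hD.self] at this
  linarith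

lemma glue_isPseudo [Nonempty W] (hD : IsPseudo D) (hδ : IsPseudo δ)
    (h : ∀ u u', δ u u' ≤ D (f u) (f u')) : IsPseudo (glue D f δ) := by
  have hsymm : ∀ x y c, glue D f δ x y < c → glue D f δ y x < c := by
    intro x y c hc
    rcases glue_lt hc with hc | ⟨u, u', hc⟩
    · exact (glue_le_base y x).trans_lt (by rwa [hD.symm])
    · refine (glue_le_via hD hδ y x u' u).trans_lt ?_
      rw [hD.symm y, hδ.symm u', hD.symm _ x]
      linarith
  refine ⟨fun x => le_antisymm ?_ (le_min (hD.self x).ge (le_ciInf fun u => ?_)), fun x y =>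
    le_antisymm (le_of_forall_gt fun c => hsymm y x c) (le_of_forall_gt fun c => hsymm x y c), ?_⟩
  · exact (glue_le_base x x).trans (hD.self x).le
  · have := hD.nonneg x (f u.1)
    have := hD.nonneg (f u.2) x
    have := hδ.nonneg u.1 u.2
    linarith
  · intro x y z
    refine le_of_forall_pos_lt_add fun ε hε => ?_
    rcases glue_lt (lt_add_of_pos_right (glue D f δ x y) (half_pos hε)) with h1 | ⟨u, u', h1⟩ <;>
    rcases glue_lt (lt_add_of_pos_right (glue D f δ y z) (half_pos hε)) with h2 | ⟨v, v', h2⟩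
    · have := hD.tri x y z
      have := glue_le_base (D := D) (f := f) (δ := δ) x z
      linarith
    · have := hD.tri x y (f v)
      have := glue_le_via (f := f) hD hδ x z v v'
      linarith
    · have := hD.tri (f u') y z
      have := glue_le_via (f := f) hD hδ x z u u'
      linarith
    · have := hD.tri (f u') y (f v)
      have := h u' v
      have := hδ.tri u u' v
      have := hδ.tri u v v'
      have := glue_le_via (f := f) hD hδ x z u v'
      linarith

end Glue

section CurveLE

variable {X : Type*} {d : X → X → ℝ}

/-- `x` and `y` are joined by `1`-Lipschitz curves defined over intervals whose length exceeds `L`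
by an arbitrarily small amount. -/
def CurveLE (d : X → X → ℝ) (x y : X) (L : ℝ) : Prop :=
  ∀ ε, 0 < ε → ∃ p : ℝ → X, (∀ s t, d (p s) (p t) ≤ |s - t|) ∧ p 0 = x ∧ p (L + ε) = y

lemma CurveLE.mono {x y : X} {L L' : ℝ} (h : CurveLE d x y L) (hL : L ≤ L') : CurveLE d x y L' := by
  intro ε hε
  obtain ⟨p, hp, h0, h1⟩ := h (L' - L + ε) (by linarith)
  exact ⟨p, hp, h0, by rw [← h1]; congr 1; ring⟩

lemma CurveLE.of_forall_pos {x y : X} {L : ℝ} (h : ∀ ε, 0 < ε → CurveLE d x y (L + ε)) :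
    CurveLE d x y L := by
  intro ε hε
  obtain ⟨p, hp, h0, h1⟩ := h (ε / 2) (half_pos hε) (ε / 2) (half_pos hε)
  exact ⟨p, hp, h0, by rw [← h1]; congr 1; ring⟩

lemma CurveLE.symm {x y : X} {L : ℝ} (h : CurveLE d x y L) : CurveLE d y x L := by
  intro ε hε
  obtain ⟨p, hp, h0, h1⟩ := h ε hε
  refine ⟨fun t => p (L + ε - t), fun s t => (hp _ _).trans ?_, by simpa using h1, by simpa using h0⟩
  rw [abs_sub_comm s t]
  apply le_of_eq
  congr 1
  ring

lemma CurveLE.trans (hd : IsPseudo d) {x y z : X} {L L' : ℝ} (h : CurveLE d x y L)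
    (h' : CurveLE d y z L') (hL : 0 ≤ L) (hL' : 0 ≤ L') : CurveLE d x z (L + L') := by
  intro ε hε
  obtain ⟨p, hp, hp0, hp1⟩ := h (ε / 2) (half_pos hε)
  obtain ⟨q, hq, hq0, hq1⟩ := h' (ε / 2) (half_pos hε)
  set T := L + ε / 2 with hT
  have key : ∀ s t, s ≤ T → T < t → d (p s) (q (t - T)) ≤ |s - t| := by
    intro s t hs ht
    refine (hd.tri _ (p T) _).trans ?_
    have h1 := hp s T
    have h2 := hq 0 (t - T)
    rw [hq0, ← hp1] at h2
    rw [abs_of_nonpos (by linarith)] at h1 h2 ⊢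
    linarith
  refine ⟨fun s => if s ≤ T then p s else q (s - T), fun s t => ?_, ?_, ?_⟩
  · dsimp only
    split_ifs with h1 h2 h2
    · exact hp s t
    · exact key s t h1 (not_le.1 h2)
    · rw [hd.symm, abs_sub_comm]
      exact key t s h2 (not_le.1 h1)
    · refine (hq _ _).trans (le_of_eq ?_)
      congr 1
      ring
  · exact (if_pos (by linarith)).trans hp0
  · refine (if_neg (by linarith)).trans ?_
    rw [← hq1]
    congr 1
    linarith

lemma CurveLE.of_curve {L : ℝ} (hL : 0 ≤ L) (p : ℝ → X)
    (hp : ∀ s ∈ Icc 0 L, ∀ t ∈ Icc 0 L, d (p s) (p t) ≤ |s - t|) : CurveLE d (p 0) (p L) L := by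
  intro ε hε
  refine ⟨fun s => p (projIcc 0 L hL s), fun s t => ?_, by simp, ?_⟩
  · refine (hp _ (projIcc 0 L hL s).2 _ (projIcc 0 L hL t).2).trans ?_
    exact abs_projIcc_sub_projIcc hL
  · simp [projIcc_of_right_le hL (by linarith : L ≤ L + ε)]

lemma CurveLE.refl (hd : IsPseudo d) (x : X) : CurveLE d x x 0 := fun _ _ =>
  ⟨fun _ => x, fun s t => by rw [hd.self]; exact abs_nonneg _, rfl, rfl⟩

lemma CurveLE.glue {Y W : Type*} [Nonempty W] (hd : IsPseudo d) {D : Y → Y → ℝ} {f : W → Y}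
    {δ : W → W → ℝ} {g : Y → X} (hD : IsPseudo D) (hδ : IsPseudo δ)
    (h1 : ∀ x y, CurveLE d (g x) (g y) (D x y))
    (h2 : ∀ u u', CurveLE d (g (f u)) (g (f u')) (δ u u')) (x y : Y) :
    CurveLE d (g x) (g y) (glue D f δ x y) := by
  refine .of_forall_pos fun ε hε => ?_
  rcases glue_lt (lt_add_of_pos_right (_root_.glue D f δ x y) hε) with h | ⟨u, u', h⟩
  · exact (h1 x y).mono h.le
  · exact (((h1 x (f u)).trans hd (h2 u u') (hD.nonneg _ _) (hδ.nonneg _ _)).trans hd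
      (h1 (f u') y) (add_nonneg (hD.nonneg _ _) (hδ.nonneg _ _)) (hD.nonneg _ _)).mono h.le

end CurveLE

lemma exists_curve_of_curveLE {X : Type*} [MetricSpace X] [CompactSpace X] {x y : X} {L : ℝ}
    (h : CurveLE (fun x y : X => dist x y) x y L) :
    ∃ p : ℝ → X, (∀ s t, dist (p s) (p t) ≤ |s - t|) ∧ p 0 = x ∧ p L = y := by
  choose p hp hp0 hp1 using fun n : ℕ => h (1 / ((n : ℝ) + 1)) (by positivity)
  let U : Ultrafilter ℕ := hyperfilter ℕ
  have hU : (U : Filter ℕ) ≤ atTop := Nat.hyperfilter_le_atTop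
  have key : ∀ t, ∃ z, Tendsto (fun n => p n t) U (𝓝 z) := by
    intro t
    obtain ⟨z, -, hz⟩ := isCompact_iff_ultrafilter_le_nhds'.1 (isCompact_univ (X := X))
      (U.map fun n => p n t) univ_mem
    exact ⟨z, hz⟩
  choose q hq using key
  refine ⟨q, fun s t => ?_, ?_, ?_⟩
  · exact le_of_tendsto ((hq s).dist (hq t)) (Eventually.of_forall fun n => hp n s t)
  · refine tendsto_nhds_unique (hq 0) ?_
    simp only [hp0]
    exact tendsto_const_nhds
  · refine tendsto_nhds_unique (hq L) ?_
    rw [tendsto_iff_dist_tendsto_zero]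
    refine squeeze_zero (fun _ => dist_nonneg) (fun n => ?_)
      (tendsto_one_div_add_atTop_nhds_zero_nat.mono_left hU)
    rw [← hp1 n]
    refine (hp n _ _).trans ?_
    rw [sub_add_cancel_left, abs_neg, abs_of_pos (by positivity)]

lemma gameSpaceD_of_curveLE {X : Type*} [MetricSpace X] [CompactSpace X] [Nonempty X]
    (h : ∀ x y : X, CurveLE (fun x y : X => dist x y) x y (dist x y)) :
    GameSpaceD X fun x y => dist x y := by
  refine ⟨‹_›, ⟨dist_self, fun x y => eq_of_dist_eq_zero, dist_comm, dist_triangle⟩,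
    fun u => ?_, fun x y => ?_⟩
  · obtain ⟨x, -, φ, hφ, hx⟩ := (isCompact_univ (X := X)).tendsto_subseq fun n => mem_univ (u n)
    exact ⟨x, φ, hφ, tendsto_iff_dist_tendsto_zero.1 hx⟩
  · obtain ⟨p, hp, hp0, hp1⟩ := exists_curve_of_curveLE (h x y)
    have hq : ∀ s t, dist (p (s * dist x y)) (p (t * dist x y)) ≤ |s - t| * dist x y := by
      intro s t
      refine (hp _ _).trans_eq ?_
      rw [← sub_mul, abs_mul, abs_of_nonneg dist_nonneg]
    refine ⟨fun t => p (t * dist x y), fun t _ ε hε => ?_, by simpa using hp0, by simpa using hp1,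
      le_antisymm ?_ ?_⟩
    · obtain ⟨η, hη, hηε⟩ := ENNReal.lt_iff_exists_real_btwn.1 hε
      have hη' : 0 < η := by simpa using hηε.1
      have hpos : 0 < dist x y + 1 := by positivity
      refine ⟨η / (dist x y + 1), by positivity, fun t' _ ht' => lt_of_le_of_lt ?_ hηε.2⟩
      refine ENNReal.ofReal_le_ofReal ((hq _ _).trans ?_)
      rw [abs_sub_comm]
      rw [lt_div_iff₀ hpos] at ht'
      nlinarith [abs_nonneg (t' - t)]
    · refine iSup_le ?_
      rintro ⟨N, u, hu, hu'⟩
      calc ∑ i ∈ Finset.range N, ENNReal.ofReal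
            (dist (p (u i * dist x y)) (p (u (i + 1) * dist x y)))
          ≤ ∑ i ∈ Finset.range N, ENNReal.ofReal ((u (i + 1) - u i) * dist x y) := by
            refine Finset.sum_le_sum fun i _ => ENNReal.ofReal_le_ofReal ((hq _ _).trans_eq ?_)
            rw [abs_sub_comm, abs_of_nonneg (sub_nonneg.2 (hu i.le_succ))]
        _ = ENNReal.ofReal ((u N - u 0) * dist x y) := by
            rw [← ENNReal.ofReal_sum_of_nonneg, ← Finset.sum_mul, Finset.sum_range_sub]
            exact fun i _ => mul_nonneg (sub_nonneg.2 (hu i.le_succ)) dist_nonneg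
        _ ≤ ENNReal.ofReal (dist x y) := by
            refine ENNReal.ofReal_le_ofReal (mul_le_of_le_one_left dist_nonneg ?_)
            linarith [(hu' N).2, (hu' 0).1]
    · have hu : Monotone (fun i : ℕ => if i = 0 then (0 : ℝ) else 1) := by
        refine monotone_nat_of_le_succ fun i => ?_
        split_ifs <;> norm_num at *
      refine le_trans ?_ (le_iSup (ι := ℕ × {u : ℕ → ℝ // Monotone u ∧ ∀ i, u i ∈ Icc (0 : ℝ) 1})
        (fun _ => _) ⟨1, _, hu, fun i => by split_ifs <;> simp⟩)
      simp [hp0, hp1]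

section MetricGraph

variable {V E : Type*} {G : SimpleGraph V} {ends : E → Bool → V} {C : ℝ}

open Classical in
/-- The distance on a disjoint union of unit segments indexed by `E`, where points of different
segments are at distance `C`. -/
noncomputable def segDist (C : ℝ) (p q : E × unitInterval) : ℝ :=
  if p.1 = q.1 then |(p.2 : ℝ) - q.2| else C

/-- An end of one of the segments. -/
def endPt (w : E × Bool) : E × unitInterval := (w.1, if w.2 then 1 else 0)

lemma segDist_of_eq {p q : E × unitInterval} (h : p.1 = q.1) :
    segDist C p q = |(p.2 : ℝ) - q.2| := if_pos h

lemma segDist_of_ne {p q : E × unitInterval} (h : p.1 ≠ q.1) : segDist C p q = C := if_neg h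

lemma abs_sub_unitInterval_le_one (s t : unitInterval) : |(s : ℝ) - t| ≤ 1 := by
  rw [abs_le]
  constructor <;> linarith [s.2.1, s.2.2, t.2.1, t.2.2]

lemma segDist_isPseudo (hC : 1 ≤ C) : IsPseudo (segDist C : E × unitInterval → _ → ℝ) where
  self p := by simp [segDist]
  symm p q := by
    unfold segDist
    rw [abs_sub_comm]
    by_cases h : p.1 = q.1
    · rw [if_pos h, if_pos h.symm]
    · rw [if_neg h, if_neg (Ne.symm h)]
  tri p q r := by
    unfold segDist
    have := abs_sub_unitInterval_le_one p.2 r.2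
    have := abs_sub_le (p.2 : ℝ) q.2 r.2
    have := abs_nonneg ((p.2 : ℝ) - q.2)
    have := abs_nonneg ((q.2 : ℝ) - r.2)
    split_ifs <;> first | linarith | simp_all

lemma dist_isPseudo (hG : G.Connected) (ends : E → Bool → V) :
    IsPseudo fun w w' : E × Bool => (G.dist (ends w.1 w.2) (ends w'.1 w'.2) : ℝ) where
  self w := by simp
  symm w w' := by rw [G.dist_comm]
  tri w w' w'' := by exact_mod_cast hG.dist_triangle

/-- The length metric on the metric graph with unit edges `E` attached at the vertices of `G`. -/
noncomputable def graphDist (G : SimpleGraph V) (ends : E → Bool → V) (C : ℝ) :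
    E × unitInterval → E × unitInterval → ℝ :=
  glue (segDist C) endPt fun w w' => (G.dist (ends w.1 w.2) (ends w'.1 w'.2) : ℝ)

lemma dist_le_segDist (hends : ∀ e, G.Adj (ends e false) (ends e true))
    (hC : ∀ u v, (G.dist u v : ℝ) ≤ C) (w w' : E × Bool) :
    (G.dist (ends w.1 w.2) (ends w'.1 w'.2) : ℝ) ≤ segDist C (endPt w) (endPt w') := by
  obtain ⟨e, i⟩ := w
  obtain ⟨e', i'⟩ := w'
  by_cases h : e = e'
  · subst h
    have h1 := SimpleGraph.dist_eq_one_iff_adj.2 (hends e)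
    have h2 := SimpleGraph.dist_eq_one_iff_adj.2 (hends e).symm
    rw [segDist_of_eq (p := endPt (e, i)) (q := endPt (e, i')) rfl]
    cases i <;> cases i' <;> simp [endPt, h1, h2]
  · rw [segDist_of_ne h]
    exact hC _ _

lemma graphDist_isPseudo [Nonempty E] (hG : G.Connected)
    (hends : ∀ e, G.Adj (ends e false) (ends e true)) (hC1 : 1 ≤ C)
    (hC : ∀ u v, (G.dist u v : ℝ) ≤ C) : IsPseudo (graphDist G ends C) :=
  glue_isPseudo (segDist_isPseudo hC1) (dist_isPseudo hG ends) (dist_le_segDist hends hC)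

lemma segDist_endPt_false (p : E × unitInterval) : segDist C p (endPt (p.1, false)) = p.2 := by
  rw [segDist_of_eq (p := p) (q := endPt (p.1, false)) rfl]
  simp [endPt, abs_of_nonneg p.2.2.1]

lemma segDist_endPt_true (p : E × unitInterval) :
    segDist C p (endPt (p.1, true)) = 1 - p.2 := by
  rw [segDist_of_eq (p := p) (q := endPt (p.1, true)) rfl]
  simp [endPt, abs_of_nonpos (sub_nonpos.2 p.2.2.2)]

lemma segDist_endPt_not (p : E × unitInterval) (i : Bool) :
    segDist C p (endPt (p.1, i)) + segDist C p (endPt (p.1, !i)) = 1 := by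
  cases i <;> simp [segDist_endPt_false, segDist_endPt_true]

lemma exists_end_of_graphDist_lt [Nonempty E] (hG : G.Connected)
    (hends : ∀ e, G.Adj (ends e false) (ends e true)) (hC2 : 2 ≤ C)
    (hC : ∀ u v, (G.dist u v : ℝ) ≤ C) {c : ℝ} (hc : c ≤ 2) {p : E × unitInterval} {w : E × Bool}
    (h : graphDist G ends C p (endPt w) < c) :
    ∃ i, segDist C p (endPt (p.1, i)) + G.dist (ends p.1 i) (ends w.1 w.2) < c := by
  rcases glue_lt h with h | ⟨u, u', h⟩
  · by_cases hp : p.1 = w.1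
    · exact ⟨w.2, by simpa [hp] using h⟩
    · rw [segDist_of_ne hp] at h
      linarith
  · have h1 := dist_le_segDist hends hC u' w
    have h2 := (dist_isPseudo hG ends).tri u u' w
    by_cases hp : p.1 = u.1
    · refine ⟨u.2, ?_⟩
      rw [hp]
      linarith
    · have := (dist_isPseudo hG ends).nonneg u u'
      have := (segDist_isPseudo (E := E) (one_le_two.trans hC2)).nonneg (endPt u') (endPt w)
      rw [segDist_of_ne hp] at h
      linarith

lemma graphDist_endPt_le (hG : G.Connected) (hC1 : 1 ≤ C) (p : E × unitInterval) (i : Bool)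
    (w : E × Bool) :
    graphDist G ends C p (endPt w) ≤
      segDist C p (endPt (p.1, i)) + G.dist (ends p.1 i) (ends w.1 w.2) := by
  have := glue_le_via (f := endPt) (segDist_isPseudo hC1) (dist_isPseudo hG ends) p (endPt w)
    (p.1, i) w
  rwa [(segDist_isPseudo hC1).self, add_zero] at this

lemma graphDist_lt_of_lt_of_lt [Nonempty E] (hG : G.Connected)
    (hends : ∀ e, G.Adj (ends e false) (ends e true)) (hC2 : 2 ≤ C)
    (hC : ∀ u v, (G.dist u v : ℝ) ≤ C)
    (h3 : ∀ v w w', G.Adj v w → G.Adj v w' → ¬ G.Adj w w')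
    (h4 : ∀ u v w w', G.Adj u w → G.Adj u w' → G.Adj v w → G.Adj v w' → w ≠ w' → u = v)
    {rep : V → E × Bool} (hrep : ∀ v, ends (rep v).1 (rep v).2 = v)
    {v w w' : V} (hw : G.Adj v w) (hw' : G.Adj v w') (hne : w ≠ w') {p : E × unitInterval} {ρ : ℝ}
    (hρ : ρ ≤ 1 / 2) (h : graphDist G ends C p (endPt (rep w)) < 1 + ρ)
    (h' : graphDist G ends C p (endPt (rep w')) < 1 + ρ) :
    graphDist G ends C p (endPt (rep v)) < ρ := by
  obtain ⟨i, hi⟩ := exists_end_of_graphDist_lt hG hends hC2 hC (by linarith) h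
  obtain ⟨j, hj⟩ := exists_end_of_graphDist_lt hG hends hC2 hC (by linarith) h'
  have hC1 : 1 ≤ C := one_le_two.trans hC2
  have hi0 := (segDist_isPseudo hC1).nonneg p (endPt (p.1, i))
  have hj0 := (segDist_isPseudo hC1).nonneg p (endPt (p.1, j))
  rw [hrep] at hi hj
  suffices ∃ k, ends p.1 k = v ∧ segDist C p (endPt (p.1, k)) < ρ by
    obtain ⟨k, hk, hkρ⟩ := this
    refine (graphDist_endPt_le hG hC1 p k _).trans_lt ?_
    rwa [hk, hrep, SimpleGraph.dist_self, Nat.cast_zero, add_zero]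
  have key : ∀ {u a}, G.dist u a ≤ 1 → u = a ∨ G.Adj u a ∧ G.dist u a = 1 := by
    intro u a hua
    rcases Nat.le_one_iff_eq_zero_or_eq_one.1 hua with h | h
    · exact .inl (hG.dist_eq_zero_iff.1 h)
    · exact .inr ⟨SimpleGraph.dist_eq_one_iff_adj.1 h, h⟩
  rcases Bool.eq_or_eq_not j i with rfl | rfl
  · have hi1 : G.dist (ends p.1 j) w < 2 := by
      have : (G.dist (ends p.1 j) w : ℝ) < 2 := by linarith
      exact_mod_cast this
    have hj1 : G.dist (ends p.1 j) w' < 2 := by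
      have : (G.dist (ends p.1 j) w' : ℝ) < 2 := by linarith
      exact_mod_cast this
    rcases key (Nat.lt_succ_iff.1 hi1) with h1 | ⟨h1, h1'⟩ <;>
    rcases key (Nat.lt_succ_iff.1 hj1) with h2 | ⟨h2, h2'⟩
    · exact absurd (h1.symm.trans h2) hne
    · rw [h1] at h2
      exact absurd h2 (h3 v w w' hw hw')
    · rw [h2] at h1
      exact absurd h1 (h3 v w' w hw' hw)
    · refine ⟨j, h4 _ _ _ _ h1 h2 hw hw' hne, ?_⟩
      rw [h1', Nat.cast_one] at hi
      linarith
  · have hadj : G.Adj (ends p.1 i) (ends p.1 !i) := by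
      cases i
      · exact hends p.1
      · exact (hends p.1).symm
    have hsum := segDist_endPt_not (C := C) p i
    have hlt : G.dist (ends p.1 i) w + G.dist (ends p.1 !i) w' < 2 := by
      have : (G.dist (ends p.1 i) w + G.dist (ends p.1 !i) w' : ℝ) < 2 := by linarith
      exact_mod_cast this
    rcases key (u := ends p.1 i) (a := w) (by omega) with h1 | ⟨h1, h1'⟩ <;>
    rcases key (u := ends p.1 !i) (a := w') (by omega) with h2 | ⟨h2, h2'⟩
    · rw [h1, h2] at hadj
      exact absurd hadj (h3 v w w' hw hw')
    · rw [h1] at hadj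
      refine ⟨!i, h4 _ _ _ _ hadj.symm h2 hw hw' hne, ?_⟩
      rw [h2', Nat.cast_one] at hj
      linarith
    · rw [h2] at hadj
      refine ⟨i, h4 _ _ _ _ h1 hadj hw hw' hne, ?_⟩
      rw [h1', Nat.cast_one] at hi
      linarith
    · omega

end MetricGraph

section Robber

lemma copTraj_congr {Y : Type*} {k : ℕ} (c0 : Fin k → Y)
    (σ : (n : ℕ) → (Fin (n + 2) → Y) → Fin k → Y) {r r' : ℕ → Y} {n : ℕ}
    (h : ∀ i ≤ n, r i = r' i) : copTraj c0 σ r n = copTraj c0 σ r' n := by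
  cases n with
  | zero => rfl
  | succ n =>
    refine congrArg (σ n) (funext fun i => h i ?_)
    omega

lemma exists_response {Y V : Type*} {k : ℕ} (c0 : Fin k → Y)
    (σ : (n : ℕ) → (Fin (n + 2) → Y) → Fin k → Y) (loc : V → Y) (v0 : V)
    (next : V → (Fin k → Y) → V) :
    ∃ r : ℕ → V, r 0 = v0 ∧ ∀ n, r (n + 1) = next (r n) (copTraj c0 σ (loc ∘ r) n) := by
  let R : ℕ → ℕ → V := fun n => Nat.rec (fun _ => v0) (fun n Rn =>
    Function.update Rn (n + 1) (next (Rn n) (copTraj c0 σ (loc ∘ Rn) n))) n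
  have hR : ∀ n, R (n + 1) =
    Function.update (R n) (n + 1) (next (R n n) (copTraj c0 σ (loc ∘ R n) n)) := fun n => rfl
  have hle : ∀ n, ∀ i ≤ n, R n i = R i i := by
    intro n
    induction n with
    | zero => intro i hi; rw [Nat.le_zero.1 hi]
    | succ n ih =>
      intro i hi
      rcases Nat.le_succ_iff.1 hi with hi | rfl
      · rw [hR, Function.update_of_ne (by omega), ih i hi]
      · rfl
  refine ⟨fun n => R n n, rfl, fun n => ?_⟩
  change R (n + 1) (n + 1) = _
  rw [hR, Function.update_self]
  congr 1
  refine copTraj_congr c0 σ fun i hi => ?_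
  exact congrArg loc (hle n i hi)

lemma exists_adj_forall_notMem {X V : Type*} {d : X → X → ℝ} (hd : IsPseudo d) {G : SimpleGraph V}
    {N : V → Set X} {k m : ℕ} (hm : m ≤ k)
    (hN : ∀ v w w' x y, G.Adj v w → G.Adj v w' → w ≠ w' → x ∈ N w → x ∈ N w' → d x y ≤ 1 → y ∈ N v)
    {v : V} {f : Fin (k + 1) → V} (hf : Function.Injective f) (hfv : ∀ i, G.Adj v (f i))
    {x y : Fin m → X} (hy : ∀ i, y i ∉ N v) (hxy : ∀ i, d (y i) (x i) ≤ 1) :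
    ∃ w, G.Adj v w ∧ ∀ i, x i ∉ N w := by
  by_contra! h
  choose i hi using fun j => h (f j) (hfv j)
  have hinj : Function.Injective i := by
    intro j j' hj
    by_contra hne
    refine hy (i j) (hN v (f j) (f j') (x (i j)) _ (hfv j) (hfv j') (hf.ne hne) (hi j) ?_ ?_)
    · rw [hj]
      exact hi j'
    · rw [hd.symm]
      exact hxy _
  have := Fintype.card_le_of_injective i hinj
  simp only [Fintype.card_fin] at this
  omega

open Classical in
lemma not_copsWinWith {X V : Type*} {d : X → X → ℝ} (hd : IsPseudo d) {G : SimpleGraph V}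
    {loc : V → X} {N : V → Set X} {k m : ℕ} (hm : m ≤ k)
    (hloc : ∀ v w, G.Adj v w → d (loc v) (loc w) ≤ 1)
    (hN : ∀ v w w' x y, G.Adj v w → G.Adj v w' → w ≠ w' → x ∈ N w → x ∈ N w' → d x y ≤ 1 → y ∈ N v)
    (hnear : ∀ v y, d y (loc v) < 5 / 4 → y ∈ N v)
    (hdeg : ∀ v, ∃ f : Fin (k + 1) → V, Function.Injective f ∧ ∀ i, G.Adj v (f i))
    {v0 : V} {x0 : X} (hx0 : x0 ∉ N v0) : ¬ CopsWinWith X d m := by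
  intro hwin
  obtain ⟨σ, hσ⟩ := hwin (fun _ => 1) ⟨fun _ => one_pos, fun h => one_ne_zero ((summable_const_iff _).1 h)⟩ (loc v0)
    fun _ => x0
  let next : V → (Fin m → X) → V := fun v x =>
    if h : ∃ w, G.Adj v w ∧ ∀ i, x i ∉ N w then h.choose else v
  obtain ⟨r, hr0, hr⟩ := exists_response (fun _ => x0) σ loc v0 next
  obtain ⟨hlegal, hcatch⟩ := hσ (loc ∘ r) (congrArg loc hr0) fun n => by
    simp only [Function.comp, hr n, next]
    split_ifs with h
    · exact hloc _ _ h.choose_spec.1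
    · rw [hd.self]
      exact zero_le_one
  set c := copTraj (fun _ => x0) σ (loc ∘ r) with hc
  have hinv : ∀ n, ∃ y : Fin m → X, (∀ i, y i ∉ N (r n)) ∧ ∀ i, d (y i) (c n i) ≤ 1 := by
    intro n
    induction n with
    | zero =>
      refine ⟨fun _ => x0, fun _ => by rwa [hr0], fun i => ?_⟩
      change d x0 x0 ≤ 1
      rw [hd.self]
      exact zero_le_one
    | succ n ih =>
      obtain ⟨y, hy, hyc⟩ := ih
      obtain ⟨f, hf, hfv⟩ := hdeg (r n)
      have h := exists_adj_forall_notMem hd hm hN hf hfv hy hyc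
      refine ⟨c n, ?_, hlegal n⟩
      have hnext : r (n + 1) = h.choose := by
        rw [hr n]
        exact dif_pos h
      rw [hnext]
      exact h.choose_spec.2
  obtain ⟨n, i, hni⟩ := hcatch (1 / 4) (by norm_num)
  obtain ⟨y, hy, hyc⟩ := hinv n
  refine hy i (hnear _ _ ?_)
  have h1 := hd.tri (y i) (c n i) (loc (r n))
  have h2 := hyc i
  have h3 : d (c n i) (loc (r n)) < 1 / 4 := by
    rw [hd.symm]
    exact hni
  linarith

lemma lt_copNumber {X : Type*} {d : X → X → ℝ} {k : ℕ} (h : ∀ m ≤ k, ¬ CopsWinWith X d m) :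
    (k : ℕ∞) < copNumber X d := by
  have : ((k + 1 : ℕ) : ℕ∞) ≤ copNumber X d := by
    refine le_sInf ?_
    rintro _ ⟨m, rfl, hm⟩
    rw [Nat.cast_le]
    by_contra hlt
    exact h m (by omega) hm
  refine lt_of_lt_of_le ?_ this
  exact_mod_cast Nat.lt_succ_self k

variable {X P : Type*} {D : X → X → ℝ} {g : P → P → ℝ} {ι : P → X}

/-- The set of points close to `p₀`, where distances are measured first along `D` and then along
`g`. -/
def zone (D : X → X → ℝ) (g : P → P → ℝ) (ι : P → X) (p₀ : P) : Set X :=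
  {x | ∃ p, g p p₀ + D x (ι p) < 5 / 4}

lemma mem_zone_of_glue_lt [Nonempty P] (hD : IsPseudo D) (hg : IsPseudo g)
    (hgD : ∀ p q, 4 * g p q ≤ D (ι p) (ι q)) {p₀ : P} {y : X}
    (h : glue (fun x y => 4 * D x y) ι g y (ι p₀) < 5 / 4) : y ∈ zone D g ι p₀ := by
  rcases glue_lt h with h | ⟨p, q, h⟩
  · have := hD.nonneg y (ι p₀)
    refine ⟨p₀, ?_⟩
    rw [hg.self]
    linarith
  · have := hD.nonneg y (ι p)
    have := hD.nonneg (ι q) (ι p₀)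
    have := hgD q p₀
    have := hg.tri p q p₀
    exact ⟨p, by linarith⟩

lemma mem_zone_of_mem_of_mem [Nonempty P] (hD : IsPseudo D) (hg : IsPseudo g)
    (hgD : ∀ p q, 4 * g p q ≤ D (ι p) (ι q)) {v w w' : P}
    (hT : ∀ p ρ, ρ ≤ 1 / 2 → g p w < 1 + ρ → g p w' < 1 + ρ → g p v < ρ) {x y : X}
    (hx : x ∈ zone D g ι w) (hx' : x ∈ zone D g ι w')
    (hxy : glue (fun x y => 4 * D x y) ι g x y ≤ 1) : y ∈ zone D g ι v := by
  obtain ⟨q, hq⟩ := hx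
  obtain ⟨q', hq'⟩ := hx'
  obtain ⟨ε, hε, hqε, hqε'⟩ : ∃ ε > 0, g q w + D x (ι q) < 5 / 4 - ε ∧
      g q' w' + D x (ι q') < 5 / 4 - ε := by
    obtain ⟨ε, hε, h⟩ := exists_between (lt_min (sub_pos.2 hq) (sub_pos.2 hq'))
    obtain ⟨h1, h2⟩ := lt_min_iff.1 h
    exact ⟨ε, hε, by linarith, by linarith⟩
  have hu := hD.nonneg x (ι q)
  have hu' := hD.nonneg x (ι q')
  rcases glue_lt (hxy.trans_lt (lt_add_of_pos_right 1 hε)) with h | ⟨p, p', h⟩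
  · have hqq := hD.tri (ι q) x (ι q')
    have hgqq := hgD q q'
    have hqx := hD.symm (ι q) x
    have hyx := hD.symm y x
    rcases le_total (D x (ι q)) (D x (ι q')) with hle | hle
    · have h1 := hg.tri q q' w'
      have h2 := hT q (1 / 4 - D x (ι q) / 2 - ε / 2) (by linarith) (by linarith) (by linarith)
      have h3 := hg.nonneg q v
      have h4 := hD.tri y x (ι q)
      exact ⟨q, by linarith⟩
    · have h1 := hg.tri q' q w
      have h5 := hg.symm q q'
      have h2 := hT q' (1 / 4 - D x (ι q') / 2 - ε / 2) (by linarith) (by linarith) (by linarith)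
      have h3 := hg.nonneg q' v
      have h4 := hD.tri y x (ι q')
      exact ⟨q', by linarith⟩
  · have h0 := hD.nonneg x (ι p)
    have h0' := hD.nonneg (ι p') y
    have hg0 := hg.nonneg p p'
    have h1 := hg.tri p q w
    have h1' := hg.tri p q' w'
    have h2 := hgD p q
    have h2' := hgD p q'
    have h3 := hD.tri (ι p) x (ι q)
    have h3' := hD.tri (ι p) x (ι q')
    rw [hD.symm (ι p) x] at h3 h3'
    have h4 := hT p (1 / 4 + D x (ι p) / 4 - ε) (by linarith) (by linarith) (by linarith)
    have h5 := hg.tri p' p v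
    rw [hg.symm p' p] at h5
    refine ⟨p', ?_⟩
    rw [hD.symm]
    linarith

end Robber

section Sphere

open InnerProductGeometry

variable {F : Type*} [NormedAddCommGroup F] [InnerProductSpace ℝ F]

/-- The angular metric on the unit sphere. -/
noncomputable def sphereAngle (x y : Metric.sphere (0 : F) 1) : ℝ := angle (x : F) y

lemma cos_sphereAngle (x y : Metric.sphere (0 : F) 1) :
    Real.cos (sphereAngle x y) = inner ℝ (x : F) y := by
  rw [sphereAngle, cos_angle, norm_eq_of_mem_sphere, norm_eq_of_mem_sphere, mul_one, div_one]

lemma sphereAngle_self (x : Metric.sphere (0 : F) 1) : sphereAngle x x = 0 :=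
  angle_self (norm_ne_zero_iff.1 (by rw [norm_eq_of_mem_sphere]; exact one_ne_zero))

lemma sphereAngle_isPseudo : IsPseudo (sphereAngle : Metric.sphere (0 : F) 1 → _ → ℝ) where
  self := sphereAngle_self
  symm _ _ := angle_comm _ _
  tri _ _ _ := angle_le_angle_add_angle _ _ _

lemma eq_of_sphereAngle_eq_zero {x y : Metric.sphere (0 : F) 1} (h : sphereAngle x y = 0) :
    x = y := by
  have h1 := cos_sphereAngle x y
  rw [h, Real.cos_zero] at h1
  exact Subtype.ext ((inner_eq_one_iff_of_norm_eq_one (𝕜 := ℝ) (norm_eq_of_mem_sphere x)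
    (norm_eq_of_mem_sphere y)).1 h1.symm)

lemma continuous_sphereAngle (x : Metric.sphere (0 : F) 1) : Continuous (sphereAngle x) := by
  have : sphereAngle x = fun y : Metric.sphere (0 : F) 1 => Real.arccos (inner ℝ (x : F) y) := by
    funext y
    rw [sphereAngle, angle, norm_eq_of_mem_sphere, norm_eq_of_mem_sphere, mul_one, div_one]
  rw [this]
  fun_prop

lemma two_sub_two_mul_inner_le (x y : Metric.sphere (0 : F) 1) :
    2 - 2 * inner ℝ (x : F) y ≤ sphereAngle x y ^ 2 := by
  have := Real.one_sub_sq_div_two_le_cos (x := sphereAngle x y)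
  rw [cos_sphereAngle] at this
  linarith

lemma sphereAngle_le_of_inner_eq_cos {x y : Metric.sphere (0 : F) 1} {θ : ℝ}
    (h : inner ℝ (x : F) y = Real.cos θ) : sphereAngle x y ≤ |θ| := by
  rw [sphereAngle, angle, norm_eq_of_mem_sphere, norm_eq_of_mem_sphere, mul_one, div_one, h]
  rcases le_total |θ| Real.pi with hθ | hθ
  · rw [← Real.cos_abs, Real.arccos_cos (abs_nonneg _) hθ]
  · exact (Real.arccos_le_pi _).trans hθ

lemma inner_circle {a b : F} (ha : ‖a‖ = 1) (hb : ‖b‖ = 1) (hab : inner ℝ a b = 0) (θ φ : ℝ) :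
    inner ℝ (Real.cos θ • a + Real.sin θ • b) (Real.cos φ • a + Real.sin φ • b) =
      Real.cos (θ - φ) := by
  have hba : inner ℝ b a = 0 := by rw [real_inner_comm, hab]
  simp only [inner_add_left, inner_add_right, real_inner_smul_left, real_inner_smul_right,
    real_inner_self_eq_norm_sq, ha, hb, hab, hba]
  rw [Real.cos_sub]
  ring

/-- The unit speed great circle through orthogonal unit vectors. -/
noncomputable def circlePt {a b : F} (ha : ‖a‖ = 1) (hb : ‖b‖ = 1) (hab : inner ℝ a b = 0) (θ : ℝ) :
    Metric.sphere (0 : F) 1 :=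
  ⟨Real.cos θ • a + Real.sin θ • b, by
    rw [mem_sphere_zero_iff_norm, ← sq_eq_sq₀ (norm_nonneg _) zero_le_one,
      ← real_inner_self_eq_norm_sq, inner_circle ha hb hab, sub_self, Real.cos_zero, one_pow]⟩

lemma sphereAngle_circlePt_le {a b : F} (ha : ‖a‖ = 1) (hb : ‖b‖ = 1) (hab : inner ℝ a b = 0)
    (θ φ : ℝ) : sphereAngle (circlePt ha hb hab θ) (circlePt ha hb hab φ) ≤ |θ - φ| :=
  sphereAngle_le_of_inner_eq_cos (inner_circle ha hb hab θ φ)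

lemma exists_circlePt (hF : ∀ x : F, ∃ y, ‖y‖ = 1 ∧ inner ℝ x y = 0)
    (x y : Metric.sphere (0 : F) 1) :
    ∃ (b : F) (hb : ‖b‖ = 1) (hab : inner ℝ (x : F) b = 0),
      circlePt (norm_eq_of_mem_sphere x) hb hab 0 = x ∧
      circlePt (norm_eq_of_mem_sphere x) hb hab (sphereAngle x y) = y := by
  set θ := sphereAngle x y with hθ
  have hcos : inner ℝ (x : F) y = Real.cos θ := (cos_sphereAngle x y).symm
  have hx := norm_eq_of_mem_sphere x
  have hy := norm_eq_of_mem_sphere y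
  set z : F := (y : F) - Real.cos θ • (x : F) with hz
  have hyz : (y : F) = Real.cos θ • (x : F) + z := by rw [hz]; abel
  have hxz : inner ℝ (x : F) z = 0 := by
    rw [hz, inner_sub_right, real_inner_smul_right, real_inner_self_eq_norm_sq, hx, hcos]
    ring
  have hnz : ‖z‖ = Real.sin θ := by
    have hs : 0 ≤ Real.sin θ := sin_angle_nonneg _ _
    rw [← sq_eq_sq₀ (norm_nonneg _) hs, ← real_inner_self_eq_norm_sq]
    conv_lhs => rw [hz, inner_sub_left, ← hz, real_inner_smul_left, hxz, hz, inner_sub_right,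
      real_inner_smul_right, real_inner_comm (x : F), hcos, real_inner_self_eq_norm_sq, hy]
    have := Real.sin_sq_add_cos_sq θ
    linarith
  have h0 : ∀ (b : F) (hb : ‖b‖ = 1) (hab : inner ℝ (x : F) b = 0),
      circlePt (norm_eq_of_mem_sphere x) hb hab 0 = x := fun b hb hab =>
    Subtype.ext (by simp [circlePt])
  by_cases h : z = 0
  · obtain ⟨b, hb, hab⟩ := hF x
    refine ⟨b, hb, hab, h0 b hb hab, Subtype.ext ?_⟩
    rw [h, norm_zero] at hnz
    simp [circlePt, hyz, ← hnz, h]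
  · have hb : ‖(‖z‖⁻¹ • z : F)‖ = 1 := norm_smul_inv_norm h
    have hab : inner ℝ (x : F) (‖z‖⁻¹ • z) = 0 := by rw [real_inner_smul_right, hxz, mul_zero]
    refine ⟨_, hb, hab, h0 _ hb hab, Subtype.ext ?_⟩
    simp only [circlePt]
    rw [← hnz, smul_smul, mul_inv_cancel₀ (norm_ne_zero_iff.2 h), one_smul, ← hyz]

lemma CurveLE.of_sphereAngle (hF : ∀ x : F, ∃ y, ‖y‖ = 1 ∧ inner ℝ x y = 0)
    {d : Metric.sphere (0 : F) 1 → Metric.sphere (0 : F) 1 → ℝ} {L : ℝ} (hL : 0 < L)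
    (hd : ∀ x y, d x y ≤ L * sphereAngle x y) (x y : Metric.sphere (0 : F) 1) :
    CurveLE d x y (L * sphereAngle x y) := by
  obtain ⟨b, hb, hab, h0, h1⟩ := exists_circlePt hF x y
  have := CurveLE.of_curve (d := d) (L := L * sphereAngle x y)
    (mul_nonneg hL.le (sphereAngle_isPseudo.nonneg x y))
    (fun s => circlePt (norm_eq_of_mem_sphere x) hb hab (s / L)) fun s _ t _ => by
      refine (hd _ _).trans ?_
      have := sphereAngle_circlePt_le (norm_eq_of_mem_sphere x) hb hab (s / L) (t / L)
      rw [← sub_div, abs_div, abs_of_pos hL, le_div_iff₀ hL] at this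
      linarith
  rwa [zero_div, h0, mul_div_cancel_left₀ _ hL.ne', h1] at this

end Sphere

section MetricGraphCurves

variable {V E X : Type*} {G : SimpleGraph V} {ends : E → Bool → V} {C : ℝ}
  {d : X → X → ℝ} {emb : E × unitInterval → X} {vert : V → X}

lemma dist_le_graphDist_endPt [Nonempty E] (hG : G.Connected)
    (hends : ∀ e, G.Adj (ends e false) (ends e true)) (hC : ∀ u v, (G.dist u v : ℝ) ≤ C)
    (w w' : E × Bool) :
    (G.dist (ends w.1 w.2) (ends w'.1 w'.2) : ℝ) ≤ graphDist G ends C (endPt w) (endPt w') := by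
  refine le_of_forall_gt fun c hc => ?_
  rcases glue_lt hc with h | ⟨u, u', h⟩
  · exact (dist_le_segDist hends hC w w').trans_lt h
  · have h1 := dist_le_segDist hends hC w u
    have h2 := dist_le_segDist hends hC u' w'
    have h3 := (dist_isPseudo hG ends).tri w u w'
    have h4 := (dist_isPseudo hG ends).tri u u' w'
    linarith

lemma graphDist_le_via_end (hG : G.Connected) (hC1 : 1 ≤ C) {p q : E × unitInterval} {i : Bool}
    (h : ends p.1 i = ends q.1 i) : graphDist G ends C p q ≤
      segDist C p (endPt (p.1, i)) + segDist C q (endPt (q.1, i)) := by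
  have := glue_le_via (f := endPt) (segDist_isPseudo hC1) (dist_isPseudo hG ends) p q
    (p.1, i) (q.1, i)
  rwa [h, SimpleGraph.dist_self, Nat.cast_zero, add_zero,
    (segDist_isPseudo hC1).symm _ q] at this

lemma curveLE_of_segment (hd : ∀ e s t, d (emb (e, s)) (emb (e, t)) ≤ |(s : ℝ) - t|) (e : E)
    (s t : unitInterval) : CurveLE d (emb (e, s)) (emb (e, t)) |(s : ℝ) - t| := by
  have key : ∀ s t : unitInterval, s ≤ t →
      CurveLE d (emb (e, s)) (emb (e, t)) ((t : ℝ) - s) := by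
    intro s t hst
    have := CurveLE.of_curve (d := d) (L := (t : ℝ) - s) (sub_nonneg.2 hst)
      (fun u => emb (e, projIcc 0 1 zero_le_one (s + u))) fun u _ u' _ => by
        refine (hd _ _ _).trans ((abs_projIcc_sub_projIcc _).trans_eq ?_)
        rw [add_sub_add_left_eq_sub]
    rwa [add_zero, add_sub_cancel, projIcc_val, projIcc_val] at this
  rcases le_total s t with h | h
  · rw [abs_sub_comm, abs_of_nonneg (sub_nonneg.2 (Subtype.coe_le_coe.2 h))]
    exact key s t h
  · rw [abs_of_nonneg (sub_nonneg.2 (Subtype.coe_le_coe.2 h))]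
    exact (key t s h).symm

lemma curveLE_dist (hd : IsPseudo d) (hG : G.Connected)
    (h : ∀ u v, G.Adj u v → CurveLE d (vert u) (vert v) 1) (u v : V) :
    CurveLE d (vert u) (vert v) (G.dist u v) := by
  obtain ⟨p, hp⟩ := hG.exists_walk_length_eq_dist u v
  rw [← hp]
  clear hp
  induction p with
  | nil => simpa using CurveLE.refl hd _
  | cons hadj p ih =>
    rw [SimpleGraph.Walk.length_cons, Nat.cast_add, Nat.cast_one, add_comm]
    exact (h _ _ hadj).trans hd ih zero_le_one (Nat.cast_nonneg _)

lemma CurveLE.graphDist [Nonempty E] (hd : IsPseudo d) (hG : G.Connected)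
    (hE : ∀ u v, G.Adj u v → ∃ e i, ends e i = u ∧ ends e (!i) = v)
    (hC1 : 1 ≤ C) (hC : ∀ u v, (G.dist u v : ℝ) + 2 ≤ C)
    (hvert : ∀ w, emb (endPt w) = vert (ends w.1 w.2))
    (hemb : ∀ p q, d (emb p) (emb q) ≤ graphDist G ends C p q) (p q : E × unitInterval) :
    CurveLE d (emb p) (emb q) (graphDist G ends C p q) := by
  have hseg : ∀ p q, p.1 = q.1 → CurveLE d (emb p) (emb q) (segDist C p q) := by
    rintro ⟨e, s⟩ ⟨e', t⟩ h
    rw [segDist_of_eq h]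
    obtain rfl : e = e' := h
    refine curveLE_of_segment (fun e s t => (hemb _ _).trans ?_) e s t
    exact (glue_le_base _ _).trans_eq (segDist_of_eq rfl)
  have hdist : ∀ w w' : E × Bool, CurveLE d (emb (endPt w)) (emb (endPt w'))
      (G.dist (ends w.1 w.2) (ends w'.1 w'.2)) := by
    intro w w'
    rw [hvert, hvert]
    refine curveLE_dist hd hG (fun u v huv => ?_) _ _
    obtain ⟨e, i, rfl, rfl⟩ := hE u v huv
    have h1 := hseg (endPt (e, i)) (endPt (e, !i)) rfl
    have h2 := segDist_endPt_not (C := C) (endPt (e, i)) i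
    have h3 : segDist C (endPt (e, i)) (endPt ((endPt (e, i)).1, i)) = 0 :=
      (segDist_isPseudo hC1).self _
    rw [h3, zero_add] at h2
    rw [hvert, hvert] at h1
    exact h1.mono h2.le
  refine CurveLE.glue hd (segDist_isPseudo hC1) (dist_isPseudo hG ends) (fun p q => ?_) hdist p q
  by_cases h : p.1 = q.1
  · exact hseg p q h
  · rw [segDist_of_ne h]
    have hnn := (segDist_isPseudo (E := E) hC1).nonneg
    have h1 := hseg p (endPt (p.1, false)) rfl
    have h2 := hseg (endPt (q.1, false)) q rfl
    have h3 := segDist_endPt_not (C := C) p false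
    have h4 := segDist_endPt_not (C := C) q false
    have h5 := hnn p (endPt (p.1, !false))
    have h6 := hnn q (endPt (q.1, !false))
    have h7 := hC (ends p.1 false) (ends q.1 false)
    refine (((h1.trans hd (hdist (p.1, false) (q.1, false)) (hnn _ _)
      (Nat.cast_nonneg _)).trans hd h2 (add_nonneg (hnn _ _) (Nat.cast_nonneg _))
      (hnn _ _)).mono ?_)
    rw [(segDist_isPseudo hC1).symm _ q]
    linarith

end MetricGraphCurves

section Bipartite

variable {A B : Type*} {R : A → B → Prop}

/-- The bipartite graph with parts `A` and `B` whose edges are given by `R`. -/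
def bipGraph (R : A → B → Prop) : SimpleGraph (A ⊕ B) where
  Adj
    | .inl a, .inr b => R a b
    | .inr b, .inl a => R a b
    | _, _ => False
  symm := ⟨by rintro (a | b) (a' | b') h <;> exact h⟩
  loopless := ⟨by rintro (a | b) h <;> exact h⟩

/-- The ends of an edge of a bipartite graph. -/
def bipEnds (e : {ab : A × B // R ab.1 ab.2}) (i : Bool) : A ⊕ B :=
  if i then .inr e.1.2 else .inl e.1.1

lemma bipGraph_adj_bipEnds (e : {ab : A × B // R ab.1 ab.2}) :
    (bipGraph R).Adj (bipEnds e false) (bipEnds e true) := e.2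

lemma exists_bipEnds_of_adj {u v : A ⊕ B} (h : (bipGraph R).Adj u v) :
    ∃ (e : {ab : A × B // R ab.1 ab.2}) (i : Bool), bipEnds e i = u ∧ bipEnds e (!i) = v := by
  rcases u with a | b <;> rcases v with a' | b'
  · exact h.elim
  · exact ⟨⟨(a, b'), h⟩, false, rfl, rfl⟩
  · exact ⟨⟨(a', b), h⟩, true, rfl, rfl⟩
  · exact h.elim

lemma bipGraph_not_adj_of_adj_of_adj (v w w' : A ⊕ B) (h : (bipGraph R).Adj v w)
    (h' : (bipGraph R).Adj v w') : ¬ (bipGraph R).Adj w w' := by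
  rcases v with a | b <;> rcases w with a' | b' <;> rcases w' with a'' | b'' <;>
    first | exact h.elim | exact h'.elim | exact fun h => h

lemma bipGraph_eq_of_common_neighbors
    (hR : ∀ a a' b b', R a b → R a b' → R a' b → R a' b' → a = a' ∨ b = b') (u v w w' : A ⊕ B)
    (h1 : (bipGraph R).Adj u w) (h2 : (bipGraph R).Adj u w') (h3 : (bipGraph R).Adj v w)
    (h4 : (bipGraph R).Adj v w') (hne : w ≠ w') : u = v := by
  rcases u with a | b <;> rcases v with a' | b' <;> rcases w with c | c <;> rcases w' with c' | c' <;>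
    first
    | exact h1.elim
    | exact h2.elim
    | exact h3.elim
    | exact h4.elim
    | skip
  · exact congrArg _ ((hR _ _ _ _ h1 h2 h3 h4).resolve_right fun h => hne (congrArg _ h))
  · exact congrArg _ ((hR _ _ _ _ h1 h3 h2 h4).resolve_left fun h => hne (congrArg _ h))

/-- The incidence relation between points and non-vertical lines of an affine plane. -/
def affIncident {K : Type*} [Field K] (a b : K × K) : Prop := a.2 = b.1 * a.1 + b.2

lemma affIncident_eq_or_eq {K : Type*} [Field K] (a a' b b' : K × K) (h1 : affIncident a b)
    (h2 : affIncident a b') (h3 : affIncident a' b) (h4 : affIncident a' b') : a = a' ∨ b = b' := by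
  obtain ⟨x, y⟩ := a
  obtain ⟨x', y'⟩ := a'
  obtain ⟨m, c⟩ := b
  obtain ⟨m', c'⟩ := b'
  simp only [affIncident] at h1 h2 h3 h4
  have h : (m - m') * (x - x') = 0 := by linear_combination h2 - h1 + h3 - h4
  rcases mul_eq_zero.1 h with h | h
  · right
    rw [sub_eq_zero.1 h] at h1 ⊢
    rw [Prod.mk.injEq]
    exact ⟨rfl, by linear_combination h2 - h1⟩
  · left
    rw [sub_eq_zero.1 h] at h1 ⊢
    rw [Prod.mk.injEq]
    exact ⟨rfl, by linear_combination h1 - h3⟩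

lemma bipGraph_affIncident_connected (K : Type*) [Field K] :
    (bipGraph (affIncident (K := K))).Connected := by
  have hinc : ∀ a b : K × K, affIncident a b →
      (bipGraph (affIncident (K := K))).Reachable (.inl a) (.inr b) := fun a b h =>
    SimpleGraph.Adj.reachable (G := bipGraph affIncident) (u := .inl a) (v := .inr b) h
  have hline : ∀ a a' b : K × K, affIncident a b → affIncident a' b →
      (bipGraph (affIncident (K := K))).Reachable (.inl a) (.inl a') := fun a a' b h h' =>
    (hinc a b h).trans (hinc a' b h').symm
  have hpt : ∀ a : K × K, (bipGraph (affIncident (K := K))).Reachable (.inl (0, 0)) (.inl a) := by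
    rintro ⟨x, y⟩
    by_cases hx : x = 0
    · subst hx
      refine (hline (0, 0) (1, 0) (0, 0) ?_ ?_).trans (hline _ _ (-y, y) ?_ ?_) <;>
        simp [affIncident]
    · refine hline _ _ (y / x, 0) ?_ ?_
      · simp [affIncident]
      · simp [affIncident, hx]
  refine SimpleGraph.Connected.mk (nonempty := ⟨.inl (0, 0)⟩) fun u v => ?_
  have h0 : ∀ u, (bipGraph (affIncident (K := K))).Reachable (.inl (0, 0)) u := by
    rintro (a | b)
    · exact hpt a
    · exact (hpt (0, b.2)).trans (hinc _ _ (by simp [affIncident]))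
  exact (h0 u).symm.trans (h0 v)

lemma exists_injective_adj_affIncident {K : Type*} [Field K] (v : K × K ⊕ K × K) :
    ∃ f : K → K × K ⊕ K × K, Function.Injective f ∧ ∀ i, (bipGraph affIncident).Adj v (f i) := by
  rcases v with ⟨x, y⟩ | ⟨m, c⟩
  · refine ⟨fun m => .inr (m, y - m * x), fun m m' h => ?_, fun m => ?_⟩
    · simp only [Sum.inr.injEq, Prod.mk.injEq] at h
      exact h.1
    · change y = m * x + (y - m * x)
      ring
  · refine ⟨fun x => .inl (x, m * x + c), fun x x' h => ?_, fun x => rfl⟩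
    simp only [Sum.inl.injEq, Prod.mk.injEq] at h
    exact h.1

end Bipartite

section Embedding

variable {A B F : Type*} {R : A → B → Prop} [NormedAddCommGroup F] [InnerProductSpace ℝ F]
  {a : A → F} {b : B → F} (ha : ∀ i, ‖a i‖ = 1) (hb : ∀ j, ‖b j‖ = 1)
  (hab : ∀ i j, inner ℝ (a i) (b j) = 0)

/-- The geometric realization of a bipartite graph in a sphere, with quarters of great circles as
edges. -/
noncomputable def edgePt (p : {ab : A × B // R ab.1 ab.2} × unitInterval) :
    Metric.sphere (0 : F) 1 :=
  circlePt (ha p.1.1.1) (hb p.1.1.2) (hab _ _) (Real.pi / 2 * p.2)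

/-- The vertices of the geometric realization of a bipartite graph in a sphere. -/
def vertPt : A ⊕ B → Metric.sphere (0 : F) 1
  | .inl i => ⟨a i, mem_sphere_zero_iff_norm.2 (ha i)⟩
  | .inr j => ⟨b j, mem_sphere_zero_iff_norm.2 (hb j)⟩

lemma edgePt_endPt (w : {ab : A × B // R ab.1 ab.2} × Bool) :
    edgePt ha hb hab (endPt w) = vertPt ha hb (bipEnds w.1 w.2) := by
  obtain ⟨e, i⟩ := w
  cases i <;> exact Subtype.ext (by simp [edgePt, endPt, circlePt, bipEnds, vertPt])

lemma sphereAngle_edgePt_le_graphDist [Nonempty {ab : A × B // R ab.1 ab.2}]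
    (hG : (bipGraph R).Connected) {C : ℝ} (hC1 : 1 ≤ C)
    (p q : {ab : A × B // R ab.1 ab.2} × unitInterval) :
    1 / 4 * sphereAngle (edgePt ha hb hab p) (edgePt ha hb hab q) ≤
      graphDist (bipGraph R) bipEnds C p q := by
  have hang := sphereAngle_isPseudo (F := F)
  have hpi := Real.pi_le_four
  have hle : ∀ x y : Metric.sphere (0 : F) 1, 1 / 4 * sphereAngle x y ≤ 1 := fun x y => by
    have := InnerProductGeometry.angle_le_pi (x : F) y
    rw [sphereAngle]
    linarith
  refine le_glue (ρ := fun p q => 1 / 4 * sphereAngle (edgePt ha hb hab p) (edgePt ha hb hab q))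
    ?_ ?_ ?_ p q
  · have h := hang.const_mul (c := 1 / 4) (by norm_num)
    exact ⟨fun _ => h.self _, fun _ _ => h.symm _ _, fun _ _ _ => h.tri _ _ _⟩
  · rintro ⟨e, s⟩ ⟨e', t⟩
    by_cases h : e = e'
    · subst h
      rw [segDist_of_eq (p := (e, s)) (q := (e, t)) rfl]
      have h1 := sphereAngle_circlePt_le (ha e.1.1) (hb e.1.2) (hab _ _)
        (Real.pi / 2 * s) (Real.pi / 2 * t)
      rw [← mul_sub, abs_mul, abs_of_pos Real.pi_div_two_pos] at h1
      have h2 : Real.pi / 2 * |(s : ℝ) - t| ≤ 4 * |(s : ℝ) - t| :=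
        mul_le_mul_of_nonneg_right (by linarith) (abs_nonneg _)
      simp only [edgePt]
      linarith
    · rw [segDist_of_ne h]
      exact (hle _ _).trans hC1
  · intro w w'
    simp only [edgePt_endPt]
    by_cases h : bipEnds w.1 w.2 = bipEnds w'.1 w'.2
    · rw [h, hang.self, mul_zero]
      exact Nat.cast_nonneg _
    · refine (hle _ _).trans ?_
      exact_mod_cast hG.pos_dist_of_ne h

lemma graphDist_le_sphereAngle_edgePt [Nonempty {ab : A × B // R ab.1 ab.2}]
    (hG : (bipGraph R).Connected) {C η K : ℝ} (hC1 : 1 ≤ C)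
    (hC : ∀ u v, ((bipGraph R).dist u v : ℝ) ≤ C)
    (hη : η ≤ 1) (haa : ∀ i i', i ≠ i' → inner ℝ (a i) (a i') ≤ 1 - η)
    (hbb : ∀ j j', j ≠ j' → inner ℝ (b j) (b j') ≤ 1 - η) (hK : 0 ≤ K) (hK1 : 1 ≤ K ^ 2)
    (hK2 : 2 ≤ K ^ 2 * η) (hK3 : C ^ 2 ≤ K ^ 2 * (2 * η))
    (p q : {ab : A × B // R ab.1 ab.2} × unitInterval) :
    graphDist (bipGraph R) bipEnds C p q ≤
      K * sphereAngle (edgePt ha hb hab p) (edgePt ha hb hab q) := by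
  have hnn := (graphDist_isPseudo hG bipGraph_adj_bipEnds hC1 hC).nonneg p q
  refine abs_le_of_sq_le_sq' ?_ (mul_nonneg hK (sphereAngle_isPseudo.nonneg _ _)) |>.2
  rw [mul_pow]
  refine le_trans ?_ (mul_le_mul_of_nonneg_left (two_sub_two_mul_inner_le _ _) (sq_nonneg K))
  obtain ⟨⟨⟨i, j⟩, hij⟩, s⟩ := p
  obtain ⟨⟨⟨i', j'⟩, hij'⟩, t⟩ := q
  obtain ⟨s, hs0, hs1⟩ := s
  obtain ⟨t, ht0, ht1⟩ := t
  have hinner : inner ℝ (edgePt ha hb hab (⟨(i, j), hij⟩, ⟨s, hs0, hs1⟩) : F)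
      (edgePt ha hb hab (⟨(i', j'), hij'⟩, ⟨t, ht0, ht1⟩)) =
      Real.cos (Real.pi / 2 * s) * Real.cos (Real.pi / 2 * t) * inner ℝ (a i) (a i') +
      Real.sin (Real.pi / 2 * s) * Real.sin (Real.pi / 2 * t) * inner ℝ (b j) (b j') := by
    have hba : ∀ j i, inner ℝ (b j) (a i) = 0 := fun j i => by rw [real_inner_comm, hab]
    simp only [edgePt, circlePt, inner_add_left, inner_add_right, real_inner_smul_left,
      real_inner_smul_right, hab, hba]
    ring
  rw [hinner]
  have hpi := Real.pi_pos
  have hsin : ∀ {x : ℝ}, 0 ≤ x → x ≤ 1 → x ≤ Real.sin (Real.pi / 2 * x) := fun h0 h1 => by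
    have := Real.mul_le_sin (x := Real.pi / 2 * _) (mul_nonneg Real.pi_div_two_pos.le h0)
      (mul_le_of_le_one_right Real.pi_div_two_pos.le h1)
    convert this using 1
    field_simp
  have hcos : ∀ {x : ℝ}, 0 ≤ x → x ≤ 1 → 1 - x ≤ Real.cos (Real.pi / 2 * x) := fun h0 h1 => by
    have := hsin (sub_nonneg.2 h1) (sub_le_self 1 h0)
    rwa [mul_one_sub, Real.sin_pi_div_two_sub] at this
  have hdiff : Real.cos (Real.pi / 2 * s) * Real.cos (Real.pi / 2 * t) +
      Real.sin (Real.pi / 2 * s) * Real.sin (Real.pi / 2 * t) ≤ 1 - (s - t) ^ 2 / 2 := by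
    rw [← Real.cos_sub, ← mul_sub]
    have := Real.cos_le_one_sub_mul_cos_sq (x := Real.pi / 2 * (s - t)) (by
      rw [abs_mul, abs_of_pos Real.pi_div_two_pos]
      have : |s - t| ≤ 1 := abs_le.2 ⟨by linarith, by linarith⟩
      nlinarith)
    refine this.trans_eq ?_
    field_simp
  have hss := hsin hs0 hs1
  have hst := hsin ht0 ht1
  have hcs := hcos hs0 hs1
  have hct := hcos ht0 ht1
  set c := Real.cos (Real.pi / 2 * s)
  set c' := Real.cos (Real.pi / 2 * t)
  set σ := Real.sin (Real.pi / 2 * s)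
  set σ' := Real.sin (Real.pi / 2 * t)
  have hcc : 0 ≤ c * c' := mul_nonneg (by linarith) (by linarith)
  have hσσ : 0 ≤ σ * σ' := mul_nonneg (by linarith) (by linarith)
  have hσst : s * t ≤ σ * σ' := mul_le_mul hss hst ht0 (by linarith)
  have hcst : (1 - s) * (1 - t) ≤ c * c' := mul_le_mul hcs hct (by linarith) (by linarith)
  have hη0 : 0 ≤ η := by
    by_contra hneg
    nlinarith
  have haa1 : inner ℝ (a i) (a i) = 1 := by rw [real_inner_self_eq_norm_sq, ha, one_pow]
  have hbb1 : inner ℝ (b j) (b j) = 1 := by rw [real_inner_self_eq_norm_sq, hb, one_pow]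
  by_cases hi : i = i' <;> by_cases hj : j = j'
  · subst hi hj
    have h1 : graphDist (bipGraph R) bipEnds C (⟨(i, j), hij⟩, ⟨s, hs0, hs1⟩)
        (⟨(i, j), hij'⟩, ⟨t, ht0, ht1⟩) ≤ |s - t| :=
      (glue_le_base _ _).trans_eq (segDist_of_eq rfl)
    have h2 := pow_le_pow_left₀ hnn h1 2
    rw [sq_abs] at h2
    rw [haa1, hbb1]
    refine h2.trans ?_
    have h3 : (s - t) ^ 2 ≤ 2 - 2 * (c * c' * 1 + σ * σ' * 1) := by linarith
    have h4 := mul_le_mul hK1 h3 (sq_nonneg _) (sq_nonneg K)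
    rwa [one_mul] at h4
  · subst hi
    have h1 := graphDist_le_via_end (ends := bipEnds) hG hC1 (i := false)
      (p := (⟨(i, j), hij⟩, ⟨s, hs0, hs1⟩)) (q := (⟨(i, j'), hij'⟩, ⟨t, ht0, ht1⟩)) rfl
    rw [segDist_endPt_false, segDist_endPt_false] at h1
    refine (pow_le_pow_left₀ hnn h1 2).trans ?_
    rw [haa1]
    have h2 := mul_le_mul_of_nonneg_left (hbb j j' hj) hσσ
    have h3 : (s - t) ^ 2 + 2 * η * (s * t) ≤
        2 - 2 * (c * c' * 1 + σ * σ' * inner ℝ (b j) (b j')) := by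
      nlinarith
    refine le_trans ?_ (mul_le_mul_of_nonneg_left h3 (sq_nonneg K))
    nlinarith [mul_nonneg hs0 ht0, sq_nonneg (s - t)]
  · subst hj
    have h1 := graphDist_le_via_end (ends := bipEnds) hG hC1 (i := true)
      (p := (⟨(i, j), hij⟩, ⟨s, hs0, hs1⟩)) (q := (⟨(i', j), hij'⟩, ⟨t, ht0, ht1⟩)) rfl
    rw [segDist_endPt_true, segDist_endPt_true] at h1
    refine (pow_le_pow_left₀ hnn h1 2).trans ?_
    rw [hbb1]
    have h2 := mul_le_mul_of_nonneg_left (haa i i' hi) hcc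
    have h3 : (s - t) ^ 2 + 2 * η * ((1 - s) * (1 - t)) ≤
        2 - 2 * (c * c' * inner ℝ (a i) (a i') + σ * σ' * 1) := by
      nlinarith
    refine le_trans ?_ (mul_le_mul_of_nonneg_left h3 (sq_nonneg K))
    nlinarith [mul_nonneg (sub_nonneg.2 hs1) (sub_nonneg.2 ht1), sq_nonneg (s - t)]
  · have h1 := (glue_le_base _ _ : graphDist (bipGraph R) bipEnds C
      (⟨(i, j), hij⟩, ⟨s, hs0, hs1⟩) (⟨(i', j'), hij'⟩, ⟨t, ht0, ht1⟩) ≤ _)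
    rw [segDist_of_ne (by simp [hi])] at h1
    refine (pow_le_pow_left₀ hnn h1 2).trans (hK3.trans ?_)
    refine mul_le_mul_of_nonneg_left ?_ (sq_nonneg K)
    have h2 := mul_le_mul_of_nonneg_left (hbb j j' hj) hσσ
    have h3 := mul_le_mul_of_nonneg_left (haa i i' hi) hcc
    have h4 : (c * c' + σ * σ') * (1 - η) ≤ 1 * (1 - η) :=
      mul_le_mul_of_nonneg_right (by nlinarith [sq_nonneg (s - t)]) (by linarith)
    linarith

end Embedding

section Vectors

lemma exists_cos_sub_le (A : Type*) [Finite A] :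
    ∃ (t : A → ℝ) (η : ℝ), 0 < η ∧ η ≤ 1 ∧ ∀ i j, i ≠ j → Real.cos (t i - t j) ≤ 1 - η := by
  obtain ⟨N, ⟨f⟩⟩ := Finite.exists_equiv_fin A
  have hN : (0 : ℝ) < N + 1 := by positivity
  have hpi := Real.pi_gt_three
  refine ⟨fun i => ((f i : ℕ) : ℝ) / (N + 1), 2 / Real.pi ^ 2 * (1 / (N + 1)) ^ 2, by positivity,
    ?_, fun i j hij => ?_⟩
  · refine mul_le_one₀ ?_ (by positivity) (pow_le_one₀ (by positivity) ?_)
    · rw [div_le_one (by positivity)]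
      nlinarith
    · rw [div_le_one hN]
      linarith [Nat.cast_nonneg (α := ℝ) N]
  · have hne : ((f i : ℕ) : ℤ) - (f j : ℕ) ≠ 0 := by
      rw [sub_ne_zero]
      exact_mod_cast fun h => hij (f.injective (Fin.ext h))
    have h1 : (1 : ℝ) ≤ |((f i : ℕ) : ℝ) - (f j : ℕ)| := by
      exact_mod_cast Int.one_le_abs hne
    have h2 : |((f i : ℕ) : ℝ) - (f j : ℕ)| ≤ N + 1 := by
      have hi : ((f i : ℕ) : ℝ) ≤ N := by exact_mod_cast (f i).2.le
      have hj : ((f j : ℕ) : ℝ) ≤ N := by exact_mod_cast (f j).2.le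
      have hi0 : (0 : ℝ) ≤ (f i : ℕ) := Nat.cast_nonneg _
      have hj0 : (0 : ℝ) ≤ (f j : ℕ) := Nat.cast_nonneg _
      rw [abs_le]
      constructor <;> linarith
    rw [← sub_div]
    set x := (((f i : ℕ) : ℝ) - (f j : ℕ)) / (N + 1) with hx
    have hxabs : |x| = |((f i : ℕ) : ℝ) - (f j : ℕ)| / (N + 1) := by
      rw [hx, abs_div, abs_of_pos hN]
    have h3 : |x| ≤ 1 := by rwa [hxabs, div_le_one hN]
    have h4 : 1 / ((N : ℝ) + 1) ≤ |x| := by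
      rw [hxabs]
      exact div_le_div_of_nonneg_right h1 hN.le
    refine (Real.cos_le_one_sub_mul_cos_sq (by linarith)).trans ?_
    have h5 := pow_le_pow_left₀ (by positivity) h4 2
    rw [sq_abs] at h5
    have := mul_le_mul_of_nonneg_left h5 (by positivity : 0 ≤ 2 / Real.pi ^ 2)
    linarith

lemma exists_separated_vectors (A : Type*) [Finite A] {n : ℕ} (hn : 3 ≤ n) :
    ∃ (a b : A → EuclideanSpace ℝ (Fin (n + 1))) (η : ℝ), 0 < η ∧ η ≤ 1 ∧
      (∀ i, ‖a i‖ = 1) ∧ (∀ i, ‖b i‖ = 1) ∧ (∀ i j, inner ℝ (a i) (b j) = 0) ∧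
      (∀ i j, i ≠ j → inner ℝ (a i) (a j) ≤ 1 - η) ∧
      ∀ i j, i ≠ j → inner ℝ (b i) (b j) ≤ 1 - η := by
  obtain ⟨t, η, hη0, hη1, ht⟩ := exists_cos_sub_le A
  have he := (EuclideanSpace.basisFun (Fin (n + 1)) ℝ).orthonormal
  set e : ℕ → EuclideanSpace ℝ (Fin (n + 1)) := fun i =>
    EuclideanSpace.basisFun (Fin (n + 1)) ℝ (Fin.ofNat (n + 1) i) with he'
  have hnorm : ∀ i, ‖e i‖ = 1 := fun i => he.1 _
  have horth : ∀ i j, i ≤ 3 → j ≤ 3 → i ≠ j → inner ℝ (e i) (e j) = 0 := by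
    intro i j hi hj hij
    refine he.2 fun h => hij ?_
    have := congrArg Fin.val h
    simp only [Fin.val_ofNat] at this
    rwa [Nat.mod_eq_of_lt (by omega), Nat.mod_eq_of_lt (by omega)] at this
  have h01 := horth 0 1 (by norm_num) (by norm_num) (by norm_num)
  have h23 := horth 2 3 (by norm_num) (by norm_num) (by norm_num)
  refine ⟨fun i => circlePt (hnorm 0) (hnorm 1) h01 (t i),
    fun i => circlePt (hnorm 2) (hnorm 3) h23 (t i), η, hη0, hη1,
    fun i => norm_eq_of_mem_sphere _, fun i => norm_eq_of_mem_sphere _, fun i j => ?_,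
    fun i j hij => ?_, fun i j hij => ?_⟩
  · simp only [circlePt, inner_add_left, inner_add_right, real_inner_smul_left,
      real_inner_smul_right]
    rw [horth 0 2, horth 0 3, horth 1 2, horth 1 3] <;> norm_num
  · exact (inner_circle (hnorm 0) (hnorm 1) h01 _ _).trans_le (ht i j hij)
  · exact (inner_circle (hnorm 2) (hnorm 3) h23 _ _).trans_le (ht i j hij)

lemma exists_norm_one_inner_eq_zero {n : ℕ} (hn : 1 ≤ n) (x : EuclideanSpace ℝ (Fin (n + 1))) :
    ∃ y, ‖y‖ = 1 ∧ inner ℝ x y = 0 := by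
  have h1 := Submodule.finrank_add_finrank_orthogonal (ℝ ∙ x)
  have h2 := finrank_span_le_card (R := ℝ) ({x} : Set (EuclideanSpace ℝ (Fin (n + 1))))
  rw [Set.toFinset_singleton, Finset.card_singleton] at h2
  rw [finrank_euclideanSpace_fin] at h1
  have h3 : (ℝ ∙ x)ᗮ ≠ ⊥ := by
    intro h
    rw [h, finrank_bot] at h1
    omega
  obtain ⟨y, hy, hy0⟩ := Submodule.exists_mem_ne_zero_of_ne_bot h3
  refine ⟨‖y‖⁻¹ • y, norm_smul_inv_norm hy0, ?_⟩
  rw [real_inner_smul_right, Submodule.mem_orthogonal_singleton_iff_inner_right.1 hy, mul_zero]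

end Vectors

section Assembly

lemma gameSpaceD_and_nonempty_homeomorph {S Y : Type*} [TopologicalSpace S] [CompactSpace S]
    [Nonempty S] [MetricSpace Y] (e : S ≃ Y)
    (he : ∀ x, Tendsto (fun y => dist (e y) (e x)) (𝓝 x) (𝓝 0))
    (h : ∀ x y : Y, CurveLE (fun x y : Y => dist x y) x y (dist x y)) :
    GameSpaceD Y (fun x y => dist x y) ∧ Nonempty (Y ≃ₜ S) := by
  have hc : Continuous e := continuous_iff_continuousAt.2 fun x =>
    tendsto_iff_dist_tendsto_zero.2 (he x)
  let φ := hc.homeoOfEquivCompactToT2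
  have : CompactSpace Y := φ.compactSpace
  have : Nonempty Y := e.nonempty_congr.1 ‹_›
  exact ⟨gameSpaceD_of_curveLE h, ⟨φ.symm⟩⟩

/-- The metric space with a given pseudometric that separates points. -/
abbrev IsPseudo.metricSpace {X : Type*} {d : X → X → ℝ} (hd : IsPseudo d)
    (h : ∀ x y, d x y = 0 → x = y) : MetricSpace X where
  dist := d
  dist_self := hd.self
  dist_comm := hd.symm
  dist_triangle := hd.tri
  eq_of_dist_eq_zero := h _ _

lemma exists_dist_add_two_le {V : Type*} [Finite V] (G : SimpleGraph V) :
    ∃ C : ℝ, 2 ≤ C ∧ ∀ u v, (G.dist u v : ℝ) + 2 ≤ C := by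
  obtain ⟨M, hM⟩ := (Set.finite_range fun w : V × V => G.dist w.1 w.2).bddAbove
  refine ⟨M + 2, by linarith [Nat.cast_nonneg (α := ℝ) M], fun u v => ?_⟩
  have : G.dist u v ≤ M := hM ⟨(u, v), rfl⟩
  gcongr

end Assembly

/-- Remark 1 of the paper. For every `n ≥ 3` and every `k` there is a
game space `(X,d)` homeomorphic to the `n`-sphere with cop number `> k`. -/
theorem exists_sphere_n_large_cop_number (n : ℕ) (hn : 3 ≤ n) (k : ℕ) :
    ∃ (X : Type) (_ : MetricSpace X),
      GameSpaceD X (fun x y => dist x y) ∧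
      Nonempty (X ≃ₜ ↥(Metric.sphere (0 : EuclideanSpace ℝ (Fin (n + 1))) 1)) ∧
      (k : ℕ∞) < copNumber X (fun x y => dist x y) := by
  obtain ⟨p, hkp, hp⟩ := Nat.exists_infinite_primes (k + 1)
  have : Fact p.Prime := ⟨hp⟩
  let A := ZMod p × ZMod p
  let R : A → A → Prop := affIncident
  let G := bipGraph R
  let E := {ab : A × A // R ab.1 ab.2}
  have hG : G.Connected := bipGraph_affIncident_connected (ZMod p)
  have : Nonempty E := ⟨⟨((0, 0), (0, 0)), by simp [R, affIncident]⟩⟩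
  obtain ⟨C, hC2, hC⟩ := exists_dist_add_two_le G
  have hC1 : 1 ≤ C := one_le_two.trans hC2
  have hC' : ∀ u v, (G.dist u v : ℝ) ≤ C := fun u v => by linarith [hC u v]
  obtain ⟨a, b, η, hη0, hη1, ha, hb, hab, haa, hbb⟩ := exists_separated_vectors A hn
  let S := Metric.sphere (0 : EuclideanSpace ℝ (Fin (n + 1))) 1
  let emb : E × unitInterval → S := edgePt ha hb hab
  let g : E × unitInterval → E × unitInterval → ℝ := graphDist G bipEnds C
  have hg : IsPseudo g := graphDist_isPseudo hG bipGraph_adj_bipEnds hC1 hC'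
  obtain ⟨K, hK1, hKg⟩ : ∃ K ≥ 1, ∀ p q, g p q ≤ K * sphereAngle (emb p) (emb q) := by
    have hK : 1 ≤ 1 + 2 / η + C ^ 2 / (2 * η) := by
      have : 0 ≤ 2 / η + C ^ 2 / (2 * η) := by positivity
      linarith
    have hKsq := le_self_pow₀ hK two_ne_zero
    refine ⟨1 + 2 / η + C ^ 2 / (2 * η), hK, graphDist_le_sphereAngle_edgePt ha hb hab hG
      hC1 hC' hη1 haa hbb (by linarith) (hK.trans hKsq) ?_ ?_⟩
    · refine le_trans ?_ (mul_le_mul_of_nonneg_right hKsq hη0.le)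
      have : (1 + 2 / η + C ^ 2 / (2 * η)) * η = η + 2 + C ^ 2 / 2 := by field_simp
      rw [this]
      nlinarith
    · refine le_trans ?_ (mul_le_mul_of_nonneg_right hKsq (by linarith))
      have : (1 + 2 / η + C ^ 2 / (2 * η)) * (2 * η) = 2 * η + 4 + C ^ 2 := by
        field_simp
        ring
      rw [this]
      linarith
  have hK0 : 0 < K := zero_lt_one.trans_le hK1
  let D : S → S → ℝ := fun x y => 4 * K * sphereAngle x y
  have hD : IsPseudo D := sphereAngle_isPseudo.const_mul (by positivity)
  have hgD : ∀ p q, 4 * g p q ≤ D (emb p) (emb q) := fun p q => by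
    have := hKg p q
    simp only [D]
    linarith
  have hD4 : IsPseudo fun x y => 4 * D x y := hD.const_mul (by norm_num)
  let d : S → S → ℝ := glue (fun x y => 4 * D x y) emb g
  have hd : IsPseudo d := glue_isPseudo hD4 hg fun p q => by
    have := hgD p q
    have := hD.nonneg (emb p) (emb q)
    have := hg.nonneg p q
    linarith
  have hdD : ∀ x y, d x y ≤ 16 * K * sphereAngle x y := fun x y =>
    (glue_le_base x y).trans_eq (by simp only [D]; ring)
  have hdg : ∀ p q, d (emb p) (emb q) ≤ g p q := glue_image_le hD4 hg
  have hed : ∀ x y, d x y = 0 → x = y := by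
    intro x y hxy
    have hη4 : 1 / 4 * sphereAngle x y ≤ d x y :=
      le_glue (sphereAngle_isPseudo.const_mul (by norm_num)) (fun x y => by
        have := mul_le_mul_of_nonneg_right hK1 (sphereAngle_isPseudo.nonneg x y)
        have := sphereAngle_isPseudo.nonneg x y
        simp only [D]
        linarith) (sphereAngle_edgePt_le_graphDist ha hb hab hG hC1) x y
    have := sphereAngle_isPseudo.nonneg x y
    exact eq_of_sphereAngle_eq_zero (by linarith)
  have hF := exists_norm_one_inner_eq_zero (n := n) (by omega)
  have hcurve : ∀ x y, CurveLE d x y (d x y) := by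
    refine fun x y => CurveLE.glue (g := id) hd hD4 hg (fun x y => ?_) (fun p q => ?_) x y
    · exact (CurveLE.of_sphereAngle hF (by positivity) hdD x y).mono
        (le_of_eq (by simp only [D]; ring))
    · exact CurveLE.graphDist hd hG (fun u v => exists_bipEnds_of_adj) hC1 hC
        (edgePt_endPt ha hb hab) hdg p q
  have hne : Nonempty S := ⟨emb (Classical.arbitrary _)⟩
  let m : MetricSpace S := hd.metricSpace hed
  obtain ⟨h1, h2⟩ := @gameSpaceD_and_nonempty_homeomorph S S _ _ _ m (Equiv.refl S) (fun x => by
    have h := ((continuous_sphereAngle x).const_mul (16 * K)).tendsto x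
    rw [sphereAngle_self, mul_zero] at h
    exact squeeze_zero (fun y => hd.nonneg y x)
      (fun y => (hd.symm y x).trans_le (hdD x y)) h) hcurve
  refine ⟨S, m, h1, h2, lt_copNumber fun j hj => ?_⟩
  change ¬ CopsWinWith S d j
  have hrep : ∀ v, ∃ w : E × Bool, bipEnds w.1 w.2 = v := fun v => by
    obtain ⟨f, -, hf⟩ := exists_injective_adj_affIncident v
    obtain ⟨e, i, he, -⟩ := exists_bipEnds_of_adj (hf 0)
    exact ⟨(e, i), he⟩
  choose rep hrep using hrep
  have hT := fun v w w' => graphDist_lt_of_lt_of_lt (C := C) hG bipGraph_adj_bipEnds hC2 hC'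
    bipGraph_not_adj_of_adj_of_adj (bipGraph_eq_of_common_neighbors affIncident_eq_or_eq)
    hrep (v := v) (w := w) (w' := w')
  have hdist := dist_le_graphDist_endPt hG bipGraph_adj_bipEnds hC'
  obtain ⟨f, hf, hfadj⟩ := exists_injective_adj_affIncident (.inl (0, 0) : A ⊕ A)
  have hfar : 2 ≤ g (endPt (rep (f 1))) (endPt (rep (f 0))) := by
    refine le_trans ?_ (hdist (rep (f 1)) (rep (f 0)))
    rw [hrep, hrep]
    have hne : G.dist (f 1) (f 0) ≠ 1 := fun h =>
      bipGraph_not_adj_of_adj_of_adj _ _ _ (hfadj 1) (hfadj 0) (SimpleGraph.dist_eq_one_iff_adj.1 h)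
    have hpos := hG.pos_dist_of_ne (hf.ne (one_ne_zero (α := ZMod p)))
    have : 2 ≤ G.dist (f 1) (f 0) := by omega
    exact_mod_cast this
  refine not_copsWinWith (N := fun v => zone D g emb (endPt (rep v)))
    (loc := fun v => emb (endPt (rep v))) (v0 := f 0) (x0 := emb (endPt (rep (f 1)))) (G := G)
    hd hj (fun v w hvw => ?_) (fun v w w' x y hw hw' hne hx hx' hxy => ?_)
    (fun v y => mem_zone_of_glue_lt hD hg hgD) (fun v => ?_) ?_
  · refine (hdg _ _).trans ?_
    refine (glue_image_le (segDist_isPseudo hC1) (dist_isPseudo hG bipEnds) _ _).trans_eq ?_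
    rw [hrep, hrep, SimpleGraph.dist_eq_one_iff_adj.2 hvw, Nat.cast_one]
  · exact mem_zone_of_mem_of_mem hD hg hgD (fun p ρ hρ => hT v w w' hw hw' hne hρ) hx hx' hxy
  · obtain ⟨f, hf, hfv⟩ := exists_injective_adj_affIncident v
    obtain ⟨i⟩ := Function.Embedding.nonempty_of_card_le
      (α := Fin (k + 1)) (β := ZMod p) (by rwa [Fintype.card_fin, ZMod.card])
    exact ⟨f ∘ i, hf.comp i.injective, fun _ => hfv _⟩
  · rintro ⟨q, hq⟩
    have h3 := hgD (endPt (rep (f 1))) q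
    have h4 := hg.tri (endPt (rep (f 1))) q (endPt (rep (f 0)))
    have h5 := hg.nonneg (endPt (rep (f 1))) q
    linarith
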